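/- Let a > 0, B > 0, and let S have the Pareto distribution of shape a and location B. For p > 0 and integer j ≥ 0 set ℚ_j(p) = E((pS)^j e^{−pS})/j!. Then for every integer j with j > a and every integer m ≥ 1 with j + m > a, lim_{p → 0+} ℚ_{j+m}(p)/ℚ_j(p) = Γ(j + m − a) · j! / (Γ(j − a) · (j + m)!), where Γ is the Gamma function; in particular this limit equals Π_{i=0}^{m−1} (j + i − a)/(j + i + 1). -/

import Mathlib

open MeasureTheory ProbabilityTheory Filter Set Topology

lemma pareto_aux_integral (a B p : ℝ) (ha : 0 < a) (hB : 0 < B) (hp : 0 < p) (k : ℕ) :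
    ∫ x, (p * x) ^ k * Real.exp (-(p * x)) ∂(paretoMeasure B a)
      = (a * B ^ a * p ^ a) *
        ∫ u in Ioi (p * B), Real.exp (-u) * u ^ ((k : ℝ) - a - 1) := by
  have h1 : ∫ x, (p * x) ^ k * Real.exp (-(p * x)) ∂(paretoMeasure B a)
      = ∫ x, paretoPDFReal B a x * ((p * x) ^ k * Real.exp (-(p * x))) := by
    unfold paretoMeasure
    rw [integral_withDensity_eq_integral_toReal_smul]
    · refine integral_congr_ae (Eventually.of_forall fun x => ?_)
      simp only [paretoPDF, smul_eq_mul]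
      rw [ENNReal.toReal_ofReal (paretoPDFReal_nonneg hB.le ha.le x)]
    · exact (measurable_paretoPDFReal B a).ennreal_ofReal
    · exact Eventually.of_forall fun x => ENNReal.ofReal_lt_top
  have h2 : ∫ x, paretoPDFReal B a x * ((p * x) ^ k * Real.exp (-(p * x)))
      = ∫ x in Ici B, (a * B ^ a * p ^ (a + 1)) *
          (Real.exp (-(p * x)) * (p * x) ^ ((k : ℝ) - a - 1)) := by
    rw [← integral_indicator measurableSet_Ici]
    refine integral_congr_ae (Eventually.of_forall fun x => ?_)
    by_cases hx : B ≤ x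
    · have hx0 : 0 < x := hB.trans_le hx
      have hpx : 0 < p * x := mul_pos hp hx0
      simp only [paretoPDFReal, hx, if_true, Set.indicator, Set.mem_Ici]
      have e : (k : ℝ) - a - 1 = k - (a + 1) := by ring
      rw [e, Real.rpow_sub hpx, Real.rpow_natCast, Real.mul_rpow hp.le hx0.le,
        Real.rpow_neg hx0.le]
      have := (Real.rpow_pos_of_pos hp (a + 1)).ne'
      have := (Real.rpow_pos_of_pos hx0 (a + 1)).ne'
      field_simp
    · simp [paretoPDFReal, hx]
  rw [h1, h2, integral_Ici_eq_integral_Ioi, integral_const_mul,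
    integral_comp_mul_left_Ioi (fun u => Real.exp (-u) * u ^ ((k : ℝ) - a - 1)) B hp,
    Real.rpow_add_one hp.ne', smul_eq_mul]
  field_simp

lemma pareto_aux_tendsto (B s : ℝ) (_hB : 0 < B) (hs : 0 < s) :
    Tendsto (fun p : ℝ => ∫ u in Ioi (p * B), Real.exp (-u) * u ^ (s - 1)) (𝓝[>] 0)
      (𝓝 (Real.Gamma s)) := by
  rw [Real.Gamma_eq_integral hs]
  have ht : Tendsto (fun p : ℝ => p * B) (𝓝[>] 0) (𝓝 0) := by
    have : Tendsto (fun p : ℝ => p * B) (𝓝 0) (𝓝 (0 * B)) :=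
      (continuous_id.mul continuous_const).tendsto 0
    rw [zero_mul] at this
    exact this.mono_left nhdsWithin_le_nhds
  have h := (aecover_Ioi_of_Ioi (μ := volume) ht).integral_tendsto_of_countably_generated
    (Real.GammaIntegral_convergent hs)
  refine h.congr' ?_
  filter_upwards [self_mem_nhdsWithin] with p hp
  have hp : 0 < p := hp
  rw [Measure.restrict_restrict measurableSet_Ioi,
    inter_eq_self_of_subset_left (Ioi_subset_Ioi (by positivity))]

/-- Let `S` have the Pareto distribution of shape `a > 0` and location `B > 0`, and for
`p > 0` and `j ∈ ℕ` set `ℚ_j(p) = E((pS)^j e^{−pS})/j!`. Then for every integer `j > a` and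
every integer `m ≥ 1` with `j + m > a`,
`lim_{p → 0+} ℚ_{j+m}(p)/ℚ_j(p) = Γ(j + m − a) · j! / (Γ(j − a) · (j + m)!)`;
in particular this limit equals `∏_{i=0}^{m−1} (j + i − a)/(j + i + 1)`. -/
theorem pareto_mixed_poisson_general_ratio_limit
    {Ω : Type*} [MeasureSpace Ω] [IsProbabilityMeasure (ℙ : Measure Ω)]
    (a B : ℝ) (ha : 0 < a) (hB : 0 < B)
    (S : Ω → ℝ) (hS : Measurable S)
    (hlaw : Measure.map S ℙ = ProbabilityTheory.paretoMeasure B a)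
    (j : ℕ) (hj : a < j) (m : ℕ) (hm : 1 ≤ m) (hjm : a < (j : ℝ) + m) :
    Tendsto
      (fun p : ℝ =>
        ((∫ ω, (p * S ω) ^ (j + m) * Real.exp (-(p * S ω))) / (Nat.factorial (j + m) : ℝ))
          / ((∫ ω, (p * S ω) ^ j * Real.exp (-(p * S ω))) / (Nat.factorial j : ℝ)))
      (𝓝[>] 0)
      (𝓝 (Real.Gamma ((j : ℝ) + m - a) * (Nat.factorial j : ℝ)
            / (Real.Gamma ((j : ℝ) - a) * (Nat.factorial (j + m) : ℝ))))
    ∧ Real.Gamma ((j : ℝ) + m - a) * (Nat.factorial j : ℝ)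
          / (Real.Gamma ((j : ℝ) - a) * (Nat.factorial (j + m) : ℝ))
        = ∏ i ∈ Finset.range m, (((j : ℝ) + i - a) / ((j : ℝ) + i + 1)) := by
  have hG : ∀ n : ℕ, Real.Gamma ((j : ℝ) + n - a) * (Nat.factorial j : ℝ)
          / (Real.Gamma ((j : ℝ) - a) * (Nat.factorial (j + n) : ℝ))
        = ∏ i ∈ Finset.range n, (((j : ℝ) + i - a) / ((j : ℝ) + i + 1)) := by
    have hg : Real.Gamma ((j : ℝ) - a) ≠ 0 := (Real.Gamma_pos_of_pos (by linarith)).ne'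
    intro n
    induction n with
    | zero =>
      have : (Nat.factorial j : ℝ) ≠ 0 := by positivity
      simp [hg, this]
    | succ n ih =>
      rw [Finset.prod_range_succ, ← ih]
      have hn : (0 : ℝ) ≤ n := n.cast_nonneg
      have e : (j : ℝ) + (n + 1 : ℕ) - a = ((j : ℝ) + n - a) + 1 := by push_cast; ring
      rw [e, Real.Gamma_add_one (by linarith), ← add_assoc, Nat.factorial_succ]
      have : (Nat.factorial (j + n) : ℝ) ≠ 0 := by positivity
      have : (j : ℝ) + n + 1 ≠ 0 := by positivity
      push_cast
      field_simp
  refine ⟨?_, hG m⟩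
  have hg : 0 < Real.Gamma ((j : ℝ) - a) := Real.Gamma_pos_of_pos (by linarith)
  have key : ∀ (p : ℝ), 0 < p → ∀ k : ℕ,
      (∫ ω, (p * S ω) ^ k * Real.exp (-(p * S ω))) = (a * B ^ a * p ^ a) *
        ∫ u in Ioi (p * B), Real.exp (-u) * u ^ ((k : ℝ) - a - 1) := by
    intro p hp k
    rw [← pareto_aux_integral a B p ha hB hp k, ← hlaw, integral_map hS.aemeasurable]
    exact (by fun_prop : Continuous fun x : ℝ => (p * x) ^ k * Real.exp (-(p * x))).aestronglyMeasurable
  have t1 := pareto_aux_tendsto B ((j : ℝ) + m - a) hB (by linarith)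
  have t2 := pareto_aux_tendsto B ((j : ℝ) - a) hB (by linarith)
  have hf1 : (Nat.factorial (j + m) : ℝ) ≠ 0 := by positivity
  have hf2 : (Nat.factorial j : ℝ) ≠ 0 := by positivity
  have t := (t1.div_const (Nat.factorial (j + m) : ℝ)).div (t2.div_const (Nat.factorial j : ℝ))
    (div_ne_zero hg.ne' hf2)
  have e : Real.Gamma ((j : ℝ) + m - a) * (Nat.factorial j : ℝ)
            / (Real.Gamma ((j : ℝ) - a) * (Nat.factorial (j + m) : ℝ)) =
      Real.Gamma ((j : ℝ) + m - a) / (Nat.factorial (j + m) : ℝ) /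
        (Real.Gamma ((j : ℝ) - a) / (Nat.factorial j : ℝ)) := by
    field_simp
  rw [e]
  refine t.congr' ?_
  filter_upwards [self_mem_nhdsWithin] with p hp
  have hp : 0 < p := hp
  have hc : a * B ^ a * p ^ a ≠ 0 := by positivity
  rw [key p hp, key p hp]
  push_cast
  simp only [Pi.div_apply]
  rw [mul_div_assoc _ _ (Nat.factorial (j + m) : ℝ), mul_div_assoc _ _ (Nat.factorial j : ℝ),
    mul_div_mul_left _ _ hc]
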